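/- For every non-negative integer m and every integer k ≥ 2, Γ(m+1)/Γ(m+k+1/2) = (√π / 2^(2m)) · Σ_{n=0}^∞ [(m+1/2)_n · ⟨m−1/2⟩_n · (m+1/2)_{k+n} · (k+m+2n+1/2)] / [n! · (k+n)! · (2m+1)_{k+n}]. -/

import Mathlib

/-- Rising factorial (Pochhammer symbol) `(x)_n`. -/
def risingFac (x : ℝ) (n : ℕ) : ℝ := ∏ i ∈ Finset.range n, (x + i)

/-- Falling factorial `⟨x⟩_n = x(x-1)⋯(x-n+1)`. -/
def fallingFac (x : ℝ) (n : ℕ) : ℝ := ∏ i ∈ Finset.range n, (x - i)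

theorem risingFac_succ (x : ℝ) (n : ℕ) : risingFac x (n + 1) = risingFac x n * (x + n) :=
  Finset.prod_range_succ _ _

theorem fallingFac_succ (x : ℝ) (n : ℕ) : fallingFac x (n + 1) = fallingFac x n * (x - n) :=
  Finset.prod_range_succ _ _

theorem risingFac_pos {x : ℝ} (hx : 0 < x) (n : ℕ) : 0 < risingFac x n :=
  Finset.prod_pos fun i _ => by positivity

theorem Gamma_nat_add {x : ℝ} (hx : 0 < x) (k : ℕ) :
    Real.Gamma (k + x) = risingFac x k * Real.Gamma x := by
  induction k with
  | zero => simp [risingFac]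
  | succ k ih =>
    rw [show ((k + 1 : ℕ) : ℝ) + x = (k + x) + 1 by push_cast; ring,
      Real.Gamma_add_one (by positivity), ih, risingFac_succ]
    ring

/-- The well-poised term without its linear factor, scaled by `Γ(k + m + 1/2)`. -/
noncomputable def scaledCoeff (m k n : ℕ) : ℝ :=
  Real.Gamma ((m : ℝ) + k + 1 / 2) *
    (risingFac ((m : ℝ) + 1 / 2) n * fallingFac ((m : ℝ) - 1 / 2) n
      * risingFac ((m : ℝ) + 1 / 2) (k + n)) /
    ((n.factorial : ℝ) * ((k + n).factorial : ℝ) * risingFac (2 * (m : ℝ) + 1) (k + n))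

/-- The summand of the series, scaled by `Γ(k + m + 1/2)`. -/
noncomputable def scaledTerm (m k n : ℕ) : ℝ :=
  scaledCoeff m k n * ((k : ℝ) + m + 2 * n + 1 / 2)

theorem scaledCoeff_succ_right (m k n : ℕ) :
    scaledCoeff m k (n + 1) = scaledCoeff m k n *
      (((m : ℝ) + 1 / 2 + n) * ((m : ℝ) - 1 / 2 - n) * ((m : ℝ) + 1 / 2 + k + n) /
        (((n : ℝ) + 1) * ((k : ℝ) + n + 1) * (2 * (m : ℝ) + 1 + k + n))) := by
  have h := (risingFac_pos (x := 2 * (m : ℝ) + 1) (by positivity) (k + n)).ne'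
  unfold scaledCoeff
  rw [← add_assoc, risingFac_succ, fallingFac_succ, risingFac_succ, risingFac_succ,
    Nat.factorial_succ, Nat.factorial_succ]
  push_cast
  have h2 : 2 * (m : ℝ) + 1 + (k + n) ≠ 0 := by positivity
  have h3 : 2 * (m : ℝ) + 1 + k + n ≠ 0 := by positivity
  field_simp
  ring

theorem scaledCoeff_succ_left (m k n : ℕ) :
    scaledCoeff m (k + 1) n = scaledCoeff m k n *
      (((m : ℝ) + 1 / 2 + k) * ((m : ℝ) + 1 / 2 + k + n) /
        (((k : ℝ) + n + 1) * (2 * (m : ℝ) + 1 + k + n))) := by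
  have h := (risingFac_pos (x := 2 * (m : ℝ) + 1) (by positivity) (k + n)).ne'
  unfold scaledCoeff
  rw [add_right_comm k 1 n, risingFac_succ, risingFac_succ, Nat.factorial_succ,
    show (m : ℝ) + ((k + 1 : ℕ) : ℝ) + 1 / 2 = ((m : ℝ) + k + 1 / 2) + 1 by push_cast; ring,
    Real.Gamma_add_one (by positivity)]
  push_cast
  have h2 : 2 * (m : ℝ) + 1 + (k + n) ≠ 0 := by positivity
  have h3 : 2 * (m : ℝ) + 1 + k + n ≠ 0 := by positivity
  field_simp
  ring

/-- The Wilf–Zeilberger relation for `scaledTerm`. -/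
theorem scaledTerm_succ_sub (m k n : ℕ) :
    scaledTerm m (k + 1) n - scaledTerm m k n =
      scaledCoeff m k (n + 1) * ((n + 1 : ℕ) : ℝ) - scaledCoeff m k n * n := by
  unfold scaledTerm
  rw [scaledCoeff_succ_left, scaledCoeff_succ_right]
  push_cast
  have h2 : 2 * (m : ℝ) + 1 + k + n ≠ 0 := by positivity
  field_simp
  ring

theorem scaledCoeff_zero_pos (m k : ℕ) : 0 < scaledCoeff m k 0 := by
  have h1 := risingFac_pos (x := (m : ℝ) + 1 / 2) (by positivity) k
  have h2 := risingFac_pos (x := 2 * (m : ℝ) + 1) (by positivity) k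
  have h3 : 0 < Real.Gamma ((m : ℝ) + k + 1 / 2) := Real.Gamma_pos_of_pos (by positivity)
  simp only [scaledCoeff, add_zero]
  have h4 : risingFac ((m : ℝ) + 1 / 2) 0 = 1 := by simp [risingFac]
  have h5 : fallingFac ((m : ℝ) - 1 / 2) 0 = 1 := by simp [fallingFac]
  rw [h4, h5]
  positivity

/-- A majorant of the ratios `scaledCoeff m k n / scaledCoeff m k 0`, uniform in `k ≥ 2`. -/
noncomputable def coeffMajorant (m n : ℕ) : ℝ :=
  ∏ i ∈ Finset.range n,
    (((m : ℝ) + 1 / 2 + i) * |(m : ℝ) - 1 / 2 - i| / (((i : ℝ) + 1) * ((i : ℝ) + 3)))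

theorem coeffMajorant_succ (m n : ℕ) : coeffMajorant m (n + 1) = coeffMajorant m n *
    (((m : ℝ) + 1 / 2 + n) * |(m : ℝ) - 1 / 2 - n| / (((n : ℝ) + 1) * ((n : ℝ) + 3))) :=
  Finset.prod_range_succ _ _

theorem coeffMajorant_nonneg (m n : ℕ) : 0 ≤ coeffMajorant m n :=
  Finset.prod_nonneg fun i _ => by positivity

theorem abs_scaledCoeff_succ_right (m k n : ℕ) :
    |scaledCoeff m k (n + 1)| = |scaledCoeff m k n| *
      ((((m : ℝ) + 1 / 2 + n) * |(m : ℝ) - 1 / 2 - n| / ((n : ℝ) + 1)) *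
        (((m : ℝ) + 1 / 2 + k + n) / (2 * (m : ℝ) + 1 + k + n)) / ((k : ℝ) + n + 1)) := by
  have h1 : |(m : ℝ) + 1 / 2 + n| = (m : ℝ) + 1 / 2 + n := abs_of_nonneg (by positivity)
  have h2 : |(m : ℝ) + 1 / 2 + k + n| = (m : ℝ) + 1 / 2 + k + n := abs_of_nonneg (by positivity)
  have h3 : |((n : ℝ) + 1) * ((k : ℝ) + n + 1) * (2 * (m : ℝ) + 1 + k + n)| =
    ((n : ℝ) + 1) * ((k : ℝ) + n + 1) * (2 * (m : ℝ) + 1 + k + n) := abs_of_nonneg (by positivity)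
  rw [scaledCoeff_succ_right, abs_mul, abs_div, abs_mul, abs_mul, h1, h2, h3]
  congr 1
  have h4 : 2 * (m : ℝ) + 1 + k + n ≠ 0 := by positivity
  field_simp

theorem add_half_div_le_one (m k n : ℕ) :
    ((m : ℝ) + 1 / 2 + k + n) / (2 * (m : ℝ) + 1 + k + n) ≤ 1 := by
  rw [div_le_one (by positivity)]
  have : (0 : ℝ) ≤ m := by positivity
  linarith

theorem abs_scaledCoeff_succ_le (m k n : ℕ) (hk : 2 ≤ k) :
    |scaledCoeff m k (n + 1)| ≤
      scaledCoeff m k 0 * (3 / ((k : ℝ) + 1)) * coeffMajorant m (n + 1) := by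
  have hk' : (2 : ℝ) ≤ k := by exact_mod_cast hk
  have hpos := scaledCoeff_zero_pos m k
  induction n with
  | zero =>
    rw [abs_scaledCoeff_succ_right, coeffMajorant_succ, abs_of_pos hpos, mul_assoc]
    gcongr
    have := add_half_div_le_one m k 0
    calc _ ≤ (((m : ℝ) + 1 / 2 + (0 : ℕ)) * |(m : ℝ) - 1 / 2 - (0 : ℕ)| / (((0 : ℕ) : ℝ) + 1)) * 1
          / ((k : ℝ) + (0 : ℕ) + 1) := by gcongr
      _ = _ := by simp [coeffMajorant]
  | succ n ih =>
    rw [abs_scaledCoeff_succ_right, coeffMajorant_succ m (n + 1), ← mul_assoc]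
    have := add_half_div_le_one m k (n + 1)
    have hc := coeffMajorant_nonneg m (n + 1)
    refine mul_le_mul ih ?_ (by positivity) (by positivity)
    calc _ ≤ (((m : ℝ) + 1 / 2 + (n + 1 : ℕ)) * |(m : ℝ) - 1 / 2 - (n + 1 : ℕ)| /
            (((n + 1 : ℕ) : ℝ) + 1)) * 1 / (((n + 1 : ℕ) : ℝ) + 3) := by
          gcongr ?_ * ?_ / ?_
          linarith
      _ = _ := by rw [mul_one, div_div]

theorem exists_coeffMajorant_bound (m : ℕ) :
    ∃ W : ℝ, ∀ n, coeffMajorant m n * ((n : ℝ) + 1) ^ 2 * ((n : ℝ) + 2) ≤ W := by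
  set w : ℕ → ℝ := fun n => coeffMajorant m n * ((n : ℝ) + 1) ^ 2 * ((n : ℝ) + 2) with hw
  have step : ∀ n, m ≤ n → w (n + 1) ≤ w n := by
    intro n hn
    have hn' : (m : ℝ) ≤ n := by exact_mod_cast hn
    have hm : (0 : ℝ) ≤ m := by positivity
    have habs : ((m : ℝ) + 1 / 2 + n) * |(m : ℝ) - 1 / 2 - n| ≤ ((n : ℝ) + 1 / 2) ^ 2 := by
      rw [abs_of_nonpos (by linarith)]
      nlinarith
    have hc := coeffMajorant_nonneg m n
    simp only [hw]
    rw [coeffMajorant_succ]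
    push_cast
    calc _ ≤ coeffMajorant m n * (((n : ℝ) + 1 / 2) ^ 2 / (((n : ℝ) + 1) * ((n : ℝ) + 3))) *
          ((n : ℝ) + 1 + 1) ^ 2 * ((n : ℝ) + 1 + 2) := by gcongr
      _ = coeffMajorant m n * ((((n : ℝ) + 1 / 2) ^ 2 * (n + 2) / ((n : ℝ) + 1)) * (n + 2)) := by
        field_simp
        ring
      _ ≤ coeffMajorant m n * ((((n : ℝ) + 1) ^ 2) * (n + 2)) := by
        gcongr
        rw [div_le_iff₀ (by positivity)]
        have : (0 : ℝ) ≤ n := by positivity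
        nlinarith
      _ = _ := by ring
  obtain ⟨W, hW⟩ := ((Finset.range (m + 1)).image w).bddAbove
  refine ⟨W, fun n => ?_⟩
  rcases le_total n m with h | h
  · exact hW (by simpa using ⟨n, by omega, rfl⟩)
  · have : w n ≤ w m := Nat.le_induction le_rfl (fun j hj ih => (step j hj).trans ih) n h
    exact this.trans (hW (by simpa using ⟨m, by omega, rfl⟩))

theorem summable_coeffMajorant (m : ℕ) :
    Summable fun n : ℕ => coeffMajorant m n * ((n : ℝ) + 1) := by
  obtain ⟨W, hW⟩ := exists_coeffMajorant_bound m
  have hs : Summable fun n : ℕ => W * (1 / ((n + 1 : ℕ) : ℝ) ^ 2) :=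
    ((summable_nat_add_iff 1).2 (Real.summable_one_div_nat_pow.2 one_lt_two)).mul_left W
  refine Summable.of_nonneg_of_le (fun n => mul_nonneg (coeffMajorant_nonneg m n) (by positivity))
    (fun n => ?_) hs
  have hc := coeffMajorant_nonneg m n
  rw [mul_one_div, le_div_iff₀ (by positivity)]
  refine le_trans ?_ (hW n)
  push_cast
  have : 0 ≤ coeffMajorant m n * ((n : ℝ) + 1) ^ 2 := by positivity
  nlinarith

theorem abs_scaledTerm_succ_le (m k n : ℕ) (hk : 2 ≤ k) :
    |scaledTerm m k (n + 1)| ≤ scaledTerm m k 0 * (3 / ((k : ℝ) + 1)) *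
      (coeffMajorant m (n + 1) * (((n + 1 : ℕ) : ℝ) + 1)) := by
  have hk' : (2 : ℝ) ≤ k := by exact_mod_cast hk
  have h := abs_scaledCoeff_succ_le m k n hk
  have hpos := scaledCoeff_zero_pos m k
  have hc := coeffMajorant_nonneg m (n + 1)
  unfold scaledTerm
  rw [abs_mul, abs_of_nonneg (a := (k : ℝ) + m + 2 * (n + 1 : ℕ) + 1 / 2) (by positivity)]
  calc _ ≤ (scaledCoeff m k 0 * (3 / ((k : ℝ) + 1)) * coeffMajorant m (n + 1)) *
        (((k : ℝ) + m + 1 / 2) * (((n + 1 : ℕ) : ℝ) + 1)) := by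
        gcongr
        have h1 : (0 : ℝ) ≤ m := by positivity
        have h2 : (0 : ℝ) ≤ ((n + 1 : ℕ) : ℝ) := by positivity
        nlinarith
    _ = _ := by push_cast; ring

theorem summable_scaledTerm (m k : ℕ) (hk : 2 ≤ k) : Summable (scaledTerm m k) := by
  rw [← summable_nat_add_iff 1]
  exact Summable.of_norm_bounded
    (((summable_nat_add_iff 1).2 (summable_coeffMajorant m)).mul_left _)
    (fun n => abs_scaledTerm_succ_le m k n hk)

theorem tsum_scaledTerm_succ (m k : ℕ) (hk : 2 ≤ k) :
    ∑' n, scaledTerm m (k + 1) n = ∑' n, scaledTerm m k n := by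
  have h1 := summable_scaledTerm m k hk
  have h2 := summable_scaledTerm m (k + 1) (by omega)
  have h3 := (h2.hasSum.sub h1.hasSum).tendsto_sum_nat
  have h4 : ∀ N, ∑ n ∈ Finset.range N, (scaledTerm m (k + 1) n - scaledTerm m k n) =
      scaledCoeff m k N * N := by
    intro N
    simp only [scaledTerm_succ_sub]
    rw [Finset.sum_range_sub (fun n : ℕ => scaledCoeff m k n * (n : ℝ))]
    simp
  simp only [h4] at h3
  have h5 : Filter.Tendsto (fun N : ℕ => scaledCoeff m k N * N) Filter.atTop (nhds 0) := by
    have h6 := h1.tendsto_atTop_zero.norm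
    rw [norm_zero] at h6
    refine squeeze_zero_norm (fun N => ?_) h6
    rw [scaledTerm, norm_mul, norm_mul]
    gcongr
    rw [Real.norm_of_nonneg (by positivity), Real.norm_of_nonneg (by positivity)]
    have hm : (0 : ℝ) ≤ m := by positivity
    have hN : (0 : ℝ) ≤ N := by positivity
    have hk' : (0 : ℝ) ≤ k := by positivity
    linarith
  exact sub_eq_zero.1 (tendsto_nhds_unique h3 h5)

theorem scaledTerm_zero_eq (m k : ℕ) (hk : k ≠ 0) :
    scaledTerm m k 0 = Real.Gamma ((m : ℝ) + 1 / 2) *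
      (Real.GammaSeq (2 * (m : ℝ) + 1) k / Real.GammaSeq ((m : ℝ) + 1 / 2) k ^ 2) *
      (1 + ((m : ℝ) + 1 / 2) / ((k : ℝ) + ((m : ℝ) + 1 / 2))) := by
  have hk0 : (0 : ℝ) < k := by exact_mod_cast Nat.pos_of_ne_zero hk
  have h1 := risingFac_pos (x := (m : ℝ) + 1 / 2) (by positivity) k
  have h2 := risingFac_pos (x := 2 * (m : ℝ) + 1) (by positivity) k
  have hseq : ∀ x : ℝ, Real.GammaSeq x k =
      (k : ℝ) ^ x * k.factorial / (risingFac x k * (x + k)) := by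
    intro x
    rw [← risingFac_succ]
    rfl
  have hp : (k : ℝ) ^ (2 * (m : ℝ) + 1) = ((k : ℝ) ^ ((m : ℝ) + 1 / 2)) ^ 2 := by
    rw [← Real.rpow_natCast, ← Real.rpow_mul hk0.le]
    congr 1
    push_cast
    ring
  have hpos : 0 < (k : ℝ) ^ ((m : ℝ) + 1 / 2) := by positivity
  have h4 : risingFac ((m : ℝ) + 1 / 2) 0 = 1 := by simp [risingFac]
  have h5 : fallingFac ((m : ℝ) - 1 / 2) 0 = 1 := by simp [fallingFac]
  rw [hseq, hseq, hp]
  simp only [scaledTerm, scaledCoeff, add_zero]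
  rw [h4, h5, show (m : ℝ) + k + 1 / 2 = k + (m + 1 / 2) by ring,
    Gamma_nat_add (by positivity)]
  generalize (k : ℝ) ^ ((m : ℝ) + 1 / 2) = p at *
  generalize risingFac ((m : ℝ) + 1 / 2) k = r at *
  generalize risingFac (2 * (m : ℝ) + 1) k = s at *
  generalize Real.Gamma ((m : ℝ) + 1 / 2) = g at *
  have h6 : (2 * (m : ℝ) + 1 + k) ≠ 0 := by positivity
  have h7 : (k : ℝ) + (m + 1 / 2) ≠ 0 := by positivity
  simp only [Nat.factorial_zero, Nat.cast_one, Nat.cast_zero]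
  field_simp
  ring

theorem tendsto_scaledTerm_zero (m : ℕ) :
    Filter.Tendsto (fun k => scaledTerm m k 0) Filter.atTop
      (nhds (Real.Gamma (2 * (m : ℝ) + 1) / Real.Gamma ((m : ℝ) + 1 / 2))) := by
  have hg : 0 < Real.Gamma ((m : ℝ) + 1 / 2) := Real.Gamma_pos_of_pos (by positivity)
  have h1 := Real.GammaSeq_tendsto_Gamma (2 * (m : ℝ) + 1)
  have h2 := Real.GammaSeq_tendsto_Gamma ((m : ℝ) + 1 / 2)
  have h3 : Filter.Tendsto (fun k : ℕ => 1 + ((m : ℝ) + 1 / 2) / ((k : ℝ) + ((m : ℝ) + 1 / 2)))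
      Filter.atTop (nhds (1 + 0)) :=
    tendsto_const_nhds.add (tendsto_const_nhds.div_atTop
      (Filter.tendsto_atTop_add_const_right _ _ tendsto_natCast_atTop_atTop))
  have h4 := ((h1.div (h2.pow 2) (by positivity)).const_mul
    (Real.Gamma ((m : ℝ) + 1 / 2))).mul h3
  have h5 : Real.Gamma (2 * (m : ℝ) + 1) / Real.Gamma ((m : ℝ) + 1 / 2) =
      Real.Gamma ((m : ℝ) + 1 / 2) * (Real.Gamma (2 * (m : ℝ) + 1) /
        Real.Gamma ((m : ℝ) + 1 / 2) ^ 2) * (1 + 0) := by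
    field_simp
    ring
  rw [h5]
  refine h4.congr' ?_
  filter_upwards [Filter.eventually_ne_atTop 0] with k hk
  exact (scaledTerm_zero_eq m k hk).symm

theorem tendsto_tsum_scaledTerm (m : ℕ) :
    Filter.Tendsto (fun k => ∑' n, scaledTerm m k n) Filter.atTop
      (nhds (Real.Gamma (2 * (m : ℝ) + 1) / Real.Gamma ((m : ℝ) + 1 / 2))) := by
  have h0 := tendsto_scaledTerm_zero m
  have hs := (summable_nat_add_iff 1).2 (summable_coeffMajorant m)
  set V := ∑' n : ℕ, coeffMajorant m (n + 1) * (((n + 1 : ℕ) : ℝ) + 1)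
  have hlim : Filter.Tendsto (fun k : ℕ => scaledTerm m k 0 * (3 / ((k : ℝ) + 1)) * V)
      Filter.atTop (nhds 0) := by
    have h3 : Filter.Tendsto (fun k : ℕ => 3 / ((k : ℝ) + 1)) Filter.atTop (nhds 0) :=
      tendsto_const_nhds.div_atTop
        (Filter.tendsto_atTop_add_const_right _ _ tendsto_natCast_atTop_atTop)
    simpa using (h0.mul h3).mul_const V
  have htail : Filter.Tendsto (fun k => ∑' n, scaledTerm m k (n + 1)) Filter.atTop (nhds 0) := by
    refine squeeze_zero_norm' ?_ hlim
    filter_upwards [Filter.eventually_ge_atTop 2] with k hk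
    exact tsum_of_norm_bounded (hs.hasSum.mul_left _) (fun n => abs_scaledTerm_succ_le m k n hk)
  have h := h0.add htail
  rw [add_zero] at h
  refine h.congr' ?_
  filter_upwards [Filter.eventually_ge_atTop 2] with k hk
  exact (summable_scaledTerm m k hk).tsum_eq_zero_add.symm

theorem tsum_scaledTerm (m k : ℕ) (hk : 2 ≤ k) :
    ∑' n, scaledTerm m k n = Real.Gamma (2 * (m : ℝ) + 1) / Real.Gamma ((m : ℝ) + 1 / 2) := by
  have hconst : ∀ j, k ≤ j → ∑' n, scaledTerm m j n = ∑' n, scaledTerm m k n :=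
    Nat.le_induction rfl fun j hj ih => (tsum_scaledTerm_succ m j (hk.trans hj)).trans ih
  refine tendsto_nhds_unique (tendsto_const_nhds.congr' ?_) (tendsto_tsum_scaledTerm m)
  filter_upwards [Filter.eventually_ge_atTop k] with j hj
  exact (hconst j hj).symm

theorem gamma_quotient_series (m k : ℕ) (hk : 2 ≤ k) :
    ∃ S : ℝ, Filter.Tendsto
      (fun N : ℕ => ∑ n ∈ Finset.range N,
        risingFac ((m : ℝ) + 1 / 2) n * fallingFac ((m : ℝ) - 1 / 2) n
            * risingFac ((m : ℝ) + 1 / 2) (k + n) * ((k : ℝ) + m + 2 * n + 1 / 2) /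
          ((n.factorial : ℝ) * ((k + n).factorial : ℝ) * risingFac (2 * (m : ℝ) + 1) (k + n)))
      Filter.atTop (nhds S) ∧
    Real.Gamma ((m : ℝ) + 1) / Real.Gamma ((m : ℝ) + k + 1 / 2) =
      Real.sqrt Real.pi / 2 ^ (2 * m) * S := by
  have hG : 0 < Real.Gamma ((m : ℝ) + k + 1 / 2) := Real.Gamma_pos_of_pos (by positivity)
  have hg : 0 < Real.Gamma ((m : ℝ) + 1 / 2) := Real.Gamma_pos_of_pos (by positivity)
  refine ⟨(Real.Gamma ((m : ℝ) + k + 1 / 2))⁻¹ *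
    (Real.Gamma (2 * (m : ℝ) + 1) / Real.Gamma ((m : ℝ) + 1 / 2)), ?_, ?_⟩
  · have h := (summable_scaledTerm m k hk).hasSum.mul_left (Real.Gamma ((m : ℝ) + k + 1 / 2))⁻¹
    rw [tsum_scaledTerm m k hk] at h
    refine h.tendsto_sum_nat.congr fun N => Finset.sum_congr rfl fun n _ => ?_
    unfold scaledTerm scaledCoeff
    field_simp
  · have h := Real.Gamma_mul_Gamma_add_half ((m : ℝ) + 1 / 2)
    rw [show (m : ℝ) + 1 / 2 + 1 / 2 = m + 1 by ring,
      show 2 * ((m : ℝ) + 1 / 2) = 2 * m + 1 by ring,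
      show 1 - (2 * (m : ℝ) + 1) = -((2 * m : ℕ) : ℝ) by push_cast; ring,
      Real.rpow_neg zero_le_two, Real.rpow_natCast] at h
    rw [← mul_right_inj' hg.ne']
    rw [← mul_div_assoc, h]
    field_simp
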